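/- Let p be a prime and h ≥ 1. Let D be the (possibly noncommutative) ℚ_p-algebra generated by the unramified extension ℚ_{p^h} of degree h and an element π subject to the relations π^h = p and π·x = φ(x)·π for all x ∈ ℚ_{p^h}, where φ is the Frobenius automorphism of ℚ_{p^h}/ℚ_p. Then D is a central simple ℚ_p-algebra of dimension h² over ℚ_p, and D is a division ring. -/

import Mathlib

section aux14
open Polynomial

theorem aux14_finite_order {k : Type*} [Field k] (p : ℕ) [Fact p.Prime] [Algebra (ZMod p) k]
    (h : ℕ) (z : k) (hz : z ≠ 0)
    (g : (ZMod p)[X]) (hg : g ≠ 0) (hdeg : g.natDegree < h) (hgz : aeval z g = 0) :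
    ∃ d, 0 < d ∧ d < h ∧ z ^ (p ^ d - 1) = 1 := by
  have hint : IsIntegral (ZMod p) z := IsAlgebraic.isIntegral ⟨g, hg, hgz⟩
  have hfin : FiniteDimensional (ZMod p) (IntermediateField.adjoin (ZMod p) {z}) :=
    IntermediateField.adjoin.finiteDimensional hint
  have hF : Finite (IntermediateField.adjoin (ZMod p) {z}) := Module.finite_of_finite (ZMod p)
  have := Fintype.ofFinite (IntermediateField.adjoin (ZMod p) {z})
  have hr := IntermediateField.adjoin.finrank hint
  refine ⟨(minpoly (ZMod p) z).natDegree, minpoly.natDegree_pos hint, ?_, ?_⟩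
  · exact lt_of_le_of_lt (natDegree_le_of_dvd (minpoly.dvd _ _ hgz) hg) hdeg
  · have hc := Module.card_eq_pow_finrank (K := ZMod p)
      (V := IntermediateField.adjoin (ZMod p) {z})
    rw [hr, ZMod.card] at hc
    have h1 := FiniteField.pow_card_sub_one_eq_one
      (IntermediateField.AdjoinSimple.gen (ZMod p) z) (by
        intro h0
        apply hz
        have := congrArg (algebraMap _ k) h0
        simpa using this)
    rw [hc] at h1
    have := congrArg (algebraMap _ k) h1
    simpa using this

theorem aux14_unit (p : ℕ) [Fact p.Prime] (h : ℕ) (hh : 1 ≤ h)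
    (L : Type*) [Field L] [Algebra ℚ_[p] L]
    (N : MulAlgebraNorm ℚ_[p] L) (hN : IsNonarchimedean N)
    (hext : ∀ a : ℚ_[p], N (algebraMap ℚ_[p] L a) = ‖a‖)
    (ζ : L) (hζ : IsPrimitiveRoot ζ (p ^ h - 1))
    (f : ℤ_[p][X]) (hf : f.natDegree < h) (i : ℕ) (hi : ‖f.coeff i‖ = 1) :
    N (aeval ζ (f.map (algebraMap ℤ_[p] ℚ_[p]))) = 1 := by
  have hp : p.Prime := Fact.out
  have hpos : 0 < p ^ h - 1 := Nat.sub_pos_of_lt (Nat.one_lt_pow (by omega) hp.one_lt)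
  have hNζ : N ζ = 1 := by
    have : N ζ ^ (p ^ h - 1) = 1 := by rw [← map_pow, hζ.pow_eq_one, map_one]
    exact (pow_eq_one_iff_of_nonneg (apply_nonneg N ζ) hpos.ne').1 this
  let O : Subring L :=
    { carrier := {x | N x ≤ 1}
      mul_mem' := fun {a b} ha hb => by
        simp only [Set.mem_ofPred_eq, map_mul] at *
        exact mul_le_one₀ ha (apply_nonneg N b) hb
      one_mem' := by simp
      add_mem' := fun {a b} ha hb => (hN a b).trans (max_le ha hb)
      zero_mem' := by simp
      neg_mem' := fun {a} ha => by simpa using ha }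
  let m : Ideal O :=
    { carrier := {x | N (x : L) < 1}
      add_mem' := fun {a b} ha hb => lt_of_le_of_lt (hN a b) (max_lt ha hb)
      zero_mem' := by simp
      smul_mem' := fun c x hx => by
        simp only [Set.mem_ofPred_eq, smul_eq_mul, Subring.coe_mul, map_mul] at *
        exact mul_lt_one_of_nonneg_of_lt_one_right c.2 (apply_nonneg N _) hx }
  have hmem : ∀ x : O, x ∈ m ↔ N (x : L) < 1 := fun x => Iff.rfl
  have hmax : m.IsMaximal := by
    rw [Ideal.isMaximal_iff]
    refine ⟨by rw [hmem]; simp, ?_⟩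
    intro J x hJ hx hxJ
    rw [hmem, not_lt] at hx
    have hx1 : N (x : L) = 1 := le_antisymm x.2 hx
    have hx0 : (x : L) ≠ 0 := by
      intro h0; rw [h0, map_zero] at hx1; exact zero_ne_one hx1
    have hinv : N (x : L)⁻¹ = 1 := by
      have : N ((x : L) * (x : L)⁻¹) = 1 := by rw [mul_inv_cancel₀ hx0, map_one]
      rwa [map_mul, hx1, one_mul] at this
    have := J.mul_mem_left ⟨(x : L)⁻¹, hinv.le⟩ hxJ
    convert this
    ext
    simp [inv_mul_cancel₀ hx0]
  let _ : Field (O ⧸ m) := Ideal.Quotient.field m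
  let q : O →+* O ⧸ m := Ideal.Quotient.mk m
  let j : ℤ_[p] →+* O := 
    ((algebraMap ℚ_[p] L).comp (algebraMap ℤ_[p] ℚ_[p])).codRestrict O (fun a => by
      change N _ ≤ 1
      simp only [RingHom.comp_apply]
      rw [hext]
      exact a.2)
  have hj : ∀ a, ((j a : O) : L) = algebraMap ℚ_[p] L (a : ℚ_[p]) := fun a => rfl
  have hjp : q (p : O) = 0 := by
    rw [Ideal.Quotient.eq_zero_iff_mem, hmem]
    have : N ((p : O) : L) = ‖(p : ℚ_[p])‖ := by rw [← hext]; simp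
    rw [this]
    exact Padic.norm_p_lt_one
  have : CharP (O ⧸ m) p := by
    refine (CharP.charP_iff_prime_eq_zero hp).2 ?_
    rw [← hjp, map_natCast]
  let _ : Algebra (ZMod p) (O ⧸ m) := ZMod.algebra _ p
  have hcomp : (algebraMap (ZMod p) (O ⧸ m)).comp PadicInt.toZMod = q.comp j := by
    ext a
    have ha := PadicInt.toZMod_spec a
    rw [PadicInt.maximalIdeal_eq_span_p, Ideal.mem_span_singleton] at ha
    obtain ⟨b, hb⟩ := ha
    have ha' : a = (((PadicInt.toZMod a).val : ℕ) : ℤ_[p]) + (p : ℤ_[p]) * b := by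
      rw [← hb, ← ZMod.natCast_val]; ring
    have h1 : (q.comp j) a = (((PadicInt.toZMod a).val : ℕ) : O ⧸ m) := by
      conv_lhs => rw [ha']
      simp only [RingHom.comp_apply, map_add, map_mul, map_natCast]
      rw [map_natCast] at hjp
      rw [hjp, zero_mul, add_zero]
    rw [h1, RingHom.comp_apply]
    conv_lhs => rw [← ZMod.natCast_zmod_val (PadicInt.toZMod a)]
    rw [map_natCast]
  let z : O := ⟨ζ, hNζ.le⟩
  by_contra hne
  have hval : N (aeval ζ (f.map (algebraMap ℤ_[p] ℚ_[p]))) = N ((f.eval₂ j z : O) : L) := by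
    congr 1
    have := hom_eval₂ f j O.subtype z
    rw [aeval_def, eval₂_map]
    exact this.symm
  have hlt : q (f.eval₂ j z) = 0 := by
    rw [Ideal.Quotient.eq_zero_iff_mem, hmem]
    rw [hval] at hne
    exact lt_of_le_of_ne (f.eval₂ j z).2 hne
  obtain ⟨d, hd0, hdh, hd⟩ := aux14_finite_order p h (q z) (by
      rw [Ne, Ideal.Quotient.eq_zero_iff_mem, hmem]
      simp [z, hNζ]) (f.map PadicInt.toZMod) (by
      intro h0
      have := congrArg (fun g => coeff g i) h0
      simp only [coeff_map, coeff_zero] at this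
      rw [← RingHom.mem_ker, PadicInt.ker_toZMod, IsLocalRing.mem_maximalIdeal, mem_nonunits_iff,
        PadicInt.isUnit_iff] at this
      exact this hi)
      (lt_of_le_of_lt natDegree_map_le hf) (by
      rw [aeval_def, eval₂_map, hcomp, ← hom_eval₂]
      exact hlt)
  set e := p ^ d - 1 with he
  have he0 : 0 < e := Nat.sub_pos_of_lt (Nat.one_lt_pow (by omega) hp.one_lt)
  have helt : e < p ^ h - 1 := by
    have : p ^ d < p ^ h := Nat.pow_lt_pow_right hp.one_lt hdh
    omega
  have hηne : ζ ^ e ≠ 1 := hζ.pow_ne_one_of_pos_of_lt he0.ne' helt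
  have hη : (ζ ^ e) ^ (p ^ h - 1) = 1 := by rw [← pow_mul, mul_comm, pow_mul, hζ.pow_eq_one, one_pow]
  have hsum : ∑ t ∈ Finset.range (p ^ h - 1), (ζ ^ e) ^ t = 0 := by
    have := mul_geom_sum (ζ ^ e) (p ^ h - 1)
    rw [hη, sub_self] at this
    exact (mul_eq_zero.1 this).resolve_left (sub_ne_zero.2 hηne)
  have hsum' : ∑ t ∈ Finset.range (p ^ h - 1), (z ^ e) ^ t = 0 := by
    apply Subtype.ext
    push_cast
    exact hsum
  have h2 := congrArg q hsum'
  rw [map_sum] at h2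
  simp only [map_pow, hd, one_pow, Finset.sum_const, Finset.card_range, map_zero, nsmul_eq_mul,
    mul_one] at h2
  rw [CharP.cast_eq_zero_iff (O ⧸ m) p] at h2
  have h3 : p ∣ p ^ h := dvd_pow_self p (by omega)
  have h4 := (Nat.dvd_sub_iff_right (Nat.one_le_pow _ _ hp.pos) h3).1 h2
  exact hp.one_lt.ne' (Nat.dvd_one.1 h4)

theorem aux14_values (p : ℕ) [Fact p.Prime] (h : ℕ) (hh : 1 ≤ h)
    (L : Type*) [Field L] [Algebra ℚ_[p] L] [FiniteDimensional ℚ_[p] L]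
    (hdeg : Module.finrank ℚ_[p] L = h)
    (N : MulAlgebraNorm ℚ_[p] L) (hN : IsNonarchimedean N)
    (hext : ∀ a : ℚ_[p], N (algebraMap ℚ_[p] L a) = ‖a‖)
    (ζ : L) (hζ : IsPrimitiveRoot ζ (p ^ h - 1)) (hgen : Algebra.adjoin ℚ_[p] {ζ} = ⊤)
    (x : L) (hx : x ≠ 0) : ∃ n : ℤ, N x = (p : ℝ) ^ n := by
  have hxm : x ∈ Algebra.adjoin ℚ_[p] {ζ} := by rw [hgen]; trivial
  rw [Algebra.adjoin_singleton_eq_range_aeval] at hxm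
  obtain ⟨g, hg⟩ := hxm
  have hint : IsIntegral ℚ_[p] ζ := Algebra.IsIntegral.isIntegral ζ
  have hmon := minpoly.monic hint
  set r := g %ₘ minpoly ℚ_[p] ζ with hr
  have hrx : aeval ζ r = x := by
    rw [← hg, hr]
    exact minpoly.aeval_modByMonic_minpoly g ζ
  have hrdeg : r.natDegree < h := by
    refine lt_of_lt_of_le (natDegree_modByMonic_lt g hmon (minpoly.ne_one _ _)) ?_
    rw [← hdeg]
    exact minpoly.natDegree_le ζ
  have hr0 : r ≠ 0 := by
    intro h0; rw [h0, map_zero] at hrx; exact hx hrx.symm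
  obtain ⟨i, hi, hmaxi⟩ := Finset.exists_max_image r.support (fun i => ‖r.coeff i‖)
    (support_nonempty.2 hr0)
  have hi0 : r.coeff i ≠ 0 := mem_support_iff.1 hi
  have hle : ∀ t, ‖r.coeff t / r.coeff i‖ ≤ 1 := by
    intro t
    rw [norm_div]
    apply div_le_one_of_le₀ _ (norm_nonneg _)
    by_cases ht : t ∈ r.support
    · exact hmaxi t ht
    · rw [notMem_support_iff.1 ht, norm_zero]; exact norm_nonneg _
  let w : ℕ → ℤ_[p] := fun t => ⟨r.coeff t / r.coeff i, hle t⟩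
  let f : ℤ_[p][X] := ∑ t ∈ Finset.range h, monomial t (w t)
  have hfc : ∀ t, ((f.coeff t : ℤ_[p]) : ℚ_[p]) = r.coeff t / r.coeff i := by
    intro t
    simp only [f, finsetSum_coeff, coeff_monomial, Finset.sum_ite_eq', Finset.mem_range]
    split_ifs with ht
    · rfl
    · rw [coeff_eq_zero_of_natDegree_lt (by omega)]; simp
  have hfmap : r = C (r.coeff i) * f.map (algebraMap ℤ_[p] ℚ_[p]) := by
    ext t
    rw [coeff_C_mul, coeff_map]
    have := hfc t
    change r.coeff t = r.coeff i * ((f.coeff t : ℤ_[p]) : ℚ_[p])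
    rw [this]; field_simp
  have hfdeg : f.natDegree < h := by
    rw [Nat.lt_iff_le_pred (by omega)]
    refine natDegree_sum_le_of_forall_le _ _ ?_
    intro t ht
    refine (natDegree_monomial_le _).trans ?_
    have := Finset.mem_range.1 ht
    simp; omega
  have hu := aux14_unit p h hh L N hN hext ζ hζ f hfdeg i (by
    rw [PadicInt.norm_def, hfc i, div_self hi0, norm_one])
  refine ⟨-(r.coeff i).valuation, ?_⟩
  have hxx : x = algebraMap ℚ_[p] L (r.coeff i) *
      aeval ζ (f.map (algebraMap ℤ_[p] ℚ_[p])) := by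
    rw [← hrx]
    conv_lhs => rw [hfmap]
    rw [map_mul, aeval_C]
  rw [hxx, map_mul, hu, mul_one, hext, Padic.norm_eq_zpow_neg_valuation hi0]

theorem aux14_dominant (p : ℕ) [Fact p.Prime] (h : ℕ)
    (L : Type*) [Field L] [Algebra ℚ_[p] L]
    (N : MulAlgebraNorm ℚ_[p] L) (hval : ∀ x : L, x ≠ 0 → ∃ n : ℤ, N x = (p : ℝ) ^ n)
    (r : ℝ) (hr0 : 0 < r) (hr : r ^ h = (p : ℝ)⁻¹) (c : Fin h → L) (hc : c ≠ 0) :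
    ∃ i, 0 < N (c i) * r ^ (i : ℕ) ∧
      ∀ t, t ≠ i → N (c t) * r ^ (t : ℕ) < N (c i) * r ^ (i : ℕ) := by
  have hp : p.Prime := Fact.out
  have hr1 : r ≠ 1 := by
    rintro rfl
    rw [one_pow, eq_comm, inv_eq_one] at hr
    exact hp.one_lt.ne' (by exact_mod_cast hr)
  obtain ⟨k, hk⟩ := Function.ne_iff.1 hc
  have hNpos : ∀ x : L, x ≠ 0 → 0 < N x := fun x hx => by
    obtain ⟨n, hn⟩ := hval x hx
    rw [hn]
    exact zpow_pos (by exact_mod_cast hp.pos) _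
  obtain ⟨i, -, hi⟩ := Finset.exists_max_image Finset.univ (fun i => N (c i) * r ^ (i : ℕ))
    ⟨k, Finset.mem_univ k⟩
  have hpos : 0 < N (c i) * r ^ (i : ℕ) :=
    lt_of_lt_of_le (mul_pos (hNpos _ hk) (pow_pos hr0 _)) (hi k (Finset.mem_univ k))
  refine ⟨i, hpos, fun t ht => lt_of_le_of_ne (hi t (Finset.mem_univ t)) ?_⟩
  intro heq
  have key : ∀ s : Fin h, 0 < N (c s) * r ^ (s : ℕ) →
      ∃ n : ℤ, N (c s) * r ^ (s : ℕ) = r ^ ((s : ℤ) + (h : ℤ) * n) := by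
    intro s hs
    have : c s ≠ 0 := by
      intro h0; rw [h0, map_zero, zero_mul] at hs; exact lt_irrefl _ hs
    obtain ⟨n, hn⟩ := hval _ this
    refine ⟨-n, ?_⟩
    rw [hn, zpow_add₀ hr0.ne', zpow_mul, zpow_natCast, zpow_natCast, hr, inv_zpow, zpow_neg,
      inv_inv, mul_comm]
  obtain ⟨n, hn⟩ := key i hpos
  obtain ⟨n', hn'⟩ := key t (heq ▸ hpos)
  rw [hn, hn'] at heq
  have h1 := zpow_right_injective₀ hr0 hr1 heq
  apply ht
  have h2 := congrArg (fun z : ℤ => z % (h : ℤ)) h1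
  simp only [Int.add_mul_emod_self_left] at h2
  rw [Int.emod_eq_of_lt (by omega) (by omega), Int.emod_eq_of_lt (by omega) (by omega)] at h2
  ext
  exact_mod_cast h2

theorem aux14_comm {L D : Type*} [Field L] [Ring D] (ι : L →+* D) (φ : L → L) (π : D)
    (hπx : ∀ x : L, π * ι x = ι (φ x) * π) (i : ℕ) (x : L) :
    π ^ i * ι x = ι (φ^[i] x) * π ^ i := by
  induction i generalizing x with
  | zero => simp
  | succ n ih =>
    rw [pow_succ, mul_assoc, hπx, ← mul_assoc, ih, mul_assoc, Function.iterate_succ_apply]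

theorem aux14_domain (p : ℕ) [Fact p.Prime] (h : ℕ) (hh : 1 ≤ h)
    (L : Type*) [Field L] [Algebra ℚ_[p] L]
    (N : MulAlgebraNorm ℚ_[p] L) (hN : IsNonarchimedean N)
    (hext : ∀ a : ℚ_[p], N (algebraMap ℚ_[p] L a) = ‖a‖)
    (hval : ∀ x : L, x ≠ 0 → ∃ n : ℤ, N x = (p : ℝ) ^ n)
    (φ : L ≃ₐ[ℚ_[p]] L) (hφN : ∀ x, N (φ x) = N x)
    (D : Type*) [Ring D] [Algebra ℚ_[p] D]
    (ι : L →ₐ[ℚ_[p]] D) (π : D)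
    (hπh : π ^ h = algebraMap ℚ_[p] D (p : ℚ_[p]))
    (hπx : ∀ x : L, π * ι x = ι (φ x) * π)
    (hindep : ∀ c : Fin h → L, ∑ i : Fin h, ι (c i) * π ^ (i : ℕ) = 0 → c = 0)
    (a b : Fin h → L) (ha : a ≠ 0) (hb : b ≠ 0) :
    (∑ i : Fin h, ι (a i) * π ^ (i : ℕ)) * (∑ i : Fin h, ι (b i) * π ^ (i : ℕ)) ≠ 0 := by
  have hp : p.Prime := Fact.out
  obtain ⟨r, hr0, hr⟩ : ∃ r : ℝ, 0 < r ∧ r ^ h = (p : ℝ)⁻¹ := by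
    have hp0 : (0 : ℝ) < (p : ℝ)⁻¹ := inv_pos.2 (by exact_mod_cast hp.pos)
    refine ⟨((p : ℝ)⁻¹) ^ ((h : ℝ)⁻¹), Real.rpow_pos_of_pos hp0 _, ?_⟩
    exact Real.rpow_inv_natCast_pow hp0.le (by omega)
  obtain ⟨i0, hi0, hi⟩ := aux14_dominant p h L N hval r hr0 hr a ha
  obtain ⟨j0, hj0, hj⟩ := aux14_dominant p h L N hval r hr0 hr b hb
  have hφN' : ∀ (n : ℕ) x, N (φ^[n] x) = N x := by
    intro n
    induction n with
    | zero => simp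
    | succ n ih => intro x; rw [Function.iterate_succ_apply, ih, hφN]
  let σ : Fin h × Fin h → Fin h := fun t => ⟨((t.1 : ℕ) + t.2) % h, Nat.mod_lt _ (by omega)⟩
  let T : Fin h × Fin h → L := fun t =>
    a t.1 * φ^[(t.1 : ℕ)] (b t.2) * algebraMap ℚ_[p] L ((p : ℚ_[p]) ^ (((t.1 : ℕ) + t.2) / h))
  have hpow : ∀ n : ℕ, π ^ n = ι (algebraMap ℚ_[p] L ((p : ℚ_[p]) ^ (n / h))) * π ^ (n % h) := by
    intro n
    conv_lhs => rw [← Nat.div_add_mod n h]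
    rw [pow_add, pow_mul, hπh, AlgHom.commutes, map_pow]
  have hprod : (∑ i : Fin h, ι (a i) * π ^ (i : ℕ)) * (∑ i : Fin h, ι (b i) * π ^ (i : ℕ)) =
      ∑ k : Fin h, ι (∑ t with σ t = k, T t) * π ^ (k : ℕ) := by
    rw [Finset.sum_mul_sum, ← Finset.sum_product', Finset.univ_product_univ,
      ← Finset.sum_fiberwise Finset.univ σ]
    refine Finset.sum_congr rfl fun k _ => ?_
    rw [map_sum, Finset.sum_mul]
    refine Finset.sum_congr rfl fun t ht => ?_
    have htk : ((t.1 : ℕ) + t.2) % h = k := congrArg Fin.val (Finset.mem_filter.1 ht).2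
    have hc := aux14_comm (ι : L →+* D) φ π hπx t.1 (b t.2)
    simp only [RingHom.coe_coe] at hc
    calc ι (a t.1) * π ^ (t.1 : ℕ) * (ι (b t.2) * π ^ (t.2 : ℕ))
        = ι (a t.1) * (π ^ (t.1 : ℕ) * ι (b t.2)) * π ^ (t.2 : ℕ) := by simp only [mul_assoc]
      _ = ι (a t.1) * ι (φ^[(t.1 : ℕ)] (b t.2)) * π ^ ((t.1 : ℕ) + t.2) := by
          rw [hc, pow_add]; simp only [mul_assoc]
      _ = _ := by
          rw [hpow, htk]; simp only [T, map_mul, mul_assoc]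
  intro h0
  rw [hprod] at h0
  have hC := congrFun (hindep _ h0) (σ (i0, j0))
  simp only [Pi.zero_apply] at hC
  have hTN : ∀ t, N (T t) * r ^ ((σ t : Fin h) : ℕ) =
      (N (a t.1) * r ^ (t.1 : ℕ)) * (N (b t.2) * r ^ (t.2 : ℕ)) := by
    intro t
    have : r ^ (t.1 : ℕ) * r ^ (t.2 : ℕ) =
        ((p : ℝ)⁻¹) ^ (((t.1 : ℕ) + t.2) / h) * r ^ (((t.1 : ℕ) + t.2) % h) := by
      rw [← pow_add]
      conv_lhs => rw [← Nat.div_add_mod ((t.1 : ℕ) + t.2) h]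
      rw [pow_add, pow_mul, hr]
    simp only [T, σ, map_mul, hφN', hext, norm_pow, Padic.norm_p]
    calc _ = N (a t.1) * N (b t.2) *
        (((p : ℝ)⁻¹) ^ (((t.1 : ℕ) + t.2) / h) * r ^ (((t.1 : ℕ) + t.2) % h)) := by ring
      _ = _ := by rw [← this]; ring
  have hdom := hN.apply_sum_eq_of_lt (fun x => (map_neg_eq_map N x).symm)
    (s := Finset.univ.filter fun t => σ t = σ (i0, j0)) (l := T) (k := (i0, j0))
    (by simp) (by
      intro t ht hne
      have hσ := (Finset.mem_filter.1 ht).2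
      have h1 := hTN t
      have h2 := hTN (i0, j0)
      rw [hσ] at h1
      refine lt_of_mul_lt_mul_right ?_ (pow_pos hr0 ((σ (i0, j0) : Fin h) : ℕ)).le
      rw [h1, h2]
      have nb : 0 ≤ N (b t.2) * r ^ (t.2 : ℕ) := mul_nonneg (apply_nonneg N _) (pow_pos hr0 _).le
      by_cases hti : t.1 = i0
      · have htj : t.2 ≠ j0 := fun h => hne (Prod.ext hti h)
        rw [hti]
        exact mul_lt_mul_of_pos_left (hj _ htj) hi0
      · have hle : N (b t.2) * r ^ (t.2 : ℕ) ≤ N (b j0) * r ^ (j0 : ℕ) := by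
          by_cases htj : t.2 = j0
          · rw [htj]
          · exact (hj _ htj).le
        exact lt_of_le_of_lt (mul_le_mul_of_nonneg_left hle
          (mul_nonneg (apply_nonneg N _) (pow_pos hr0 _).le))
          (mul_lt_mul_of_pos_right (hi _ hti) hj0))
  rw [hC, map_zero] at hdom
  have h2 := hTN (i0, j0)
  rw [← hdom, zero_mul] at h2
  exact (mul_pos hi0 hj0).ne h2

end aux14

/-- `ℚ_{p^h}` is modelled as a degree-`h` Galois extension `L` of `ℚ_p` generated by a
primitive `(p^h − 1)`-th root of unity `ζ` (this characterizes the unramified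
extension of degree `h`), with Frobenius `φ` determined by `φ(ζ) = ζ^p`. Let `D` be a
`ℚ_p`-algebra containing `L` (via `ι`) and an element `π` with `π^h = p`,
`π·x = φ(x)·π`, and such that `1, π, …, π^{h−1}` is a basis of `D` as a left
`L`-vector space (expressed by existence and uniqueness of the coefficients). Then
`D` is a central simple `ℚ_p`-algebra of dimension `h²`, and `D` is a division ring. -/
theorem stmt_14 (p : ℕ) [Fact p.Prime] (h : ℕ) (hh : 1 ≤ h)
    (L : Type*) [Field L] [Algebra ℚ_[p] L] [IsGalois ℚ_[p] L]
    (hdeg : Module.finrank ℚ_[p] L = h)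
    (ζ : L) (hζ : IsPrimitiveRoot ζ (p ^ h - 1)) (hgen : Algebra.adjoin ℚ_[p] {ζ} = ⊤)
    (φ : L ≃ₐ[ℚ_[p]] L) (hφ : φ ζ = ζ ^ p)
    (D : Type*) [Ring D] [Algebra ℚ_[p] D]
    (ι : L →ₐ[ℚ_[p]] D) (π : D)
    (hπh : π ^ h = algebraMap ℚ_[p] D (p : ℚ_[p]))
    (hπx : ∀ x : L, π * ι x = ι (φ x) * π)
    (hspan : ∀ d : D, ∃ c : Fin h → L, d = ∑ i : Fin h, ι (c i) * π ^ (i : ℕ))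
    (hindep : ∀ c : Fin h → L, ∑ i : Fin h, ι (c i) * π ^ (i : ℕ) = 0 → c = 0) :
    Algebra.IsCentral ℚ_[p] D ∧ IsSimpleRing D ∧
    Module.finrank ℚ_[p] D = h ^ 2 ∧
    (∀ x : D, x ≠ 0 → IsUnit x) := by
  have hp : p.Prime := Fact.out
  have hfd : FiniteDimensional ℚ_[p] L := Module.finite_of_finrank_pos (by omega)
  have hpos : 0 < p ^ h - 1 := Nat.sub_pos_of_lt (Nat.one_lt_pow (by omega) hp.one_lt)
  -- basis
  have hne1 : Nontrivial D := by
    refine ⟨1, 0, fun h10 => ?_⟩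
    have := hindep (fun _ => 1) (by rw [← mul_one (∑ _, _), h10, mul_zero])
    exact one_ne_zero (congrFun this ⟨0, by omega⟩)
  let F : (Fin h → L) →ₗ[ℚ_[p]] D :=
    { toFun := fun c => ∑ i : Fin h, ι (c i) * π ^ (i : ℕ)
      map_add' := fun c d => by simp [add_mul, Finset.sum_add_distrib]
      map_smul' := fun s c => by simp [Finset.smul_sum] }
  have hF : ∀ c, F c = ∑ i : Fin h, ι (c i) * π ^ (i : ℕ) := fun c => rfl
  have hFinj : Function.Injective F := by
    rw [injective_iff_map_eq_zero]
    exact hindep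
  have hFsurj : Function.Surjective F := fun d => by
    obtain ⟨c, hc⟩ := hspan d
    exact ⟨c, hc.symm⟩
  let E := LinearEquiv.ofBijective F ⟨hFinj, hFsurj⟩
  have hDfd : FiniteDimensional ℚ_[p] D := Module.Finite.equiv E
  -- the norm
  let N : MulAlgebraNorm ℚ_[p] L := spectralMulAlgNorm ℚ_[p] L
  have hN : IsNonarchimedean N := isNonarchimedean_spectralNorm
  have hext : ∀ a : ℚ_[p], N (algebraMap ℚ_[p] L a) = ‖a‖ := fun a => spectralNorm_extends a
  have hφN : ∀ x, N (φ x) = N x := fun x => (spectralNorm_eq_of_equiv φ x).symm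
  have hval := aux14_values p h hh L hdeg N hN hext ζ hζ hgen
  have hnzd : NoZeroDivisors D := by
    refine ⟨fun {x y} hxy => ?_⟩
    by_contra! hcon
    obtain ⟨a, rfl⟩ := hFsurj x
    obtain ⟨b, rfl⟩ := hFsurj y
    refine aux14_domain p h hh L N hN hext hval φ hφN D ι π hπh hπx hindep a b ?_ ?_ hxy
    · rintro rfl; exact hcon.1 (map_zero F)
    · rintro rfl; exact hcon.2 (map_zero F)
  have hdom : IsDomain D := NoZeroDivisors.to_isDomain D
  have hunit : ∀ x : D, x ≠ 0 → IsUnit x := fun x hx => FiniteDimensional.isUnit ℚ_[p] hx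
  -- the order of φ
  have hφit : ∀ n : ℕ, φ^[n] ζ = ζ ^ (p ^ n) := by
    intro n
    induction n with
    | zero => simp
    | succ n ih =>
      rw [Function.iterate_succ_apply', ih, map_pow, hφ, ← pow_mul, pow_succ, mul_comm]
  have hφfix : ∀ n : ℕ, n < h → φ^[n] ζ = ζ → n = 0 := by
    intro n hn hfix
    by_contra hn0
    rw [hφit] at hfix
    have h1 : 1 < p ^ n := Nat.one_lt_pow hn0 hp.one_lt
    have h2 : p ^ n < p ^ h := Nat.pow_lt_pow_right hp.one_lt hn
    have h3 : ζ ^ (p ^ n - 1) = 1 := by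
      have hζ0 : ζ ≠ 0 := hζ.ne_zero hpos.ne'
      apply mul_right_cancel₀ hζ0
      rw [one_mul, ← pow_succ, Nat.sub_add_cancel h1.le, hfix]
    exact hζ.pow_ne_one_of_pos_of_lt (by omega) (by omega) h3
  have hφgen : Subgroup.zpowers φ = ⊤ := by
    apply Subgroup.eq_top_of_card_eq
    rw [IsGalois.card_aut_eq_finrank, hdeg, Nat.card_zpowers]
    refine le_antisymm ?_ ?_
    · rw [← hdeg, ← IsGalois.card_aut_eq_finrank ℚ_[p] L]
      exact Nat.le_of_dvd Nat.card_pos (orderOf_dvd_natCard φ)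
    · by_contra! hlt
      have h1 : φ^[orderOf φ] ζ = ζ := by
        have h3 : ∀ n : ℕ, (φ ^ n) ζ = φ^[n] ζ := by
          intro n
          induction n with
          | zero => simp
          | succ n ih => rw [pow_succ', AlgEquiv.mul_apply, ih, Function.iterate_succ_apply']
        rw [← h3, pow_orderOf_eq_one, AlgEquiv.one_apply]
      exact (orderOf_pos φ).ne' (hφfix _ hlt h1)
  have hfixed : ∀ x : L, φ x = x → ∃ a, algebraMap ℚ_[p] L a = x := by
    intro x hx
    have : x ∈ (⊥ : IntermediateField ℚ_[p] L) := by
      rw [IsGalois.mem_bot_iff_fixed]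
      intro f
      have hf : f ∈ Subgroup.zpowers φ := by rw [hφgen]; trivial
      have hle : Subgroup.zpowers φ ≤ MulAction.stabilizer (L ≃ₐ[ℚ_[p]] L) x := by
        rw [Subgroup.zpowers_le]
        exact hx
      exact hle hf
    exact IntermediateField.mem_bot.1 this
  refine ⟨⟨?_⟩, ?_, ?_, hunit⟩
  · intro z hz
    rw [Subalgebra.mem_center_iff] at hz
    obtain ⟨c, rfl⟩ := hFsurj z
    have h1 := hz (ι ζ)
    have h2 : F (fun i => ζ * c i) = F (fun i => c i * φ^[(i : ℕ)] ζ) := by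
      have e1 : F (fun i => ζ * c i) = ι ζ * F c := by
        rw [hF, hF, Finset.mul_sum]
        exact Finset.sum_congr rfl fun i _ => by rw [map_mul, mul_assoc]
      have e2 : F (fun i => c i * φ^[(i : ℕ)] ζ) = F c * ι ζ := by
        rw [hF, hF, Finset.sum_mul]
        refine Finset.sum_congr rfl fun i _ => ?_
        have hc := aux14_comm (ι : L →+* D) φ π hπx i ζ
        simp only [RingHom.coe_coe] at hc
        rw [mul_assoc, hc, map_mul, mul_assoc]
      rw [e1, e2, h1]
    have h3 := hFinj h2
    have hc0 : ∀ i : Fin h, (i : ℕ) ≠ 0 → c i = 0 := by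
      intro i hi
      by_contra hci
      have h4 := congrFun h3 i
      rw [mul_comm] at h4
      exact hi (hφfix i i.2 (mul_left_cancel₀ hci h4).symm)
    let o : Fin h := ⟨0, by omega⟩
    have hFc : F c = ι (c o) := by
      rw [hF, Finset.sum_eq_single o]
      · simp [o]
      · intro i _ hi
        rw [hc0 i (fun h0 => hi (Fin.ext h0)), map_zero, zero_mul]
      · intro ho; exact absurd (Finset.mem_univ o) ho
    rw [hFc] at hz ⊢
    have h5 := hz π
    rw [hπx] at h5
    have hπ0 : π ≠ 0 := by
      rintro rfl
      rw [zero_pow (by omega), eq_comm, map_eq_zero_iff _ (algebraMap ℚ_[p] D).injective] at hπh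
      exact hp.ne_zero (by exact_mod_cast hπh)
    have h6 : φ (c o) = c o := (ι : L →+* D).injective (mul_right_cancel₀ hπ0 h5)
    obtain ⟨a, ha⟩ := hfixed _ h6
    rw [Algebra.mem_bot]
    exact ⟨a, by rw [← ha, AlgHom.commutes]⟩
  · let _ : DivisionRing D := DivisionRing.ofIsUnitOrEqZero fun a => by
      by_cases ha : a = 0
      · exact Or.inr ha
      · exact Or.inl (hunit a ha)
    infer_instance
  · rw [← E.finrank_eq, Module.finrank_pi_fintype]
    simp [hdeg, sq]
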